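/- Under the setup of the generalized beta k-function of the first kind (n ≥ 2, k > 0, a > 0, b − a > 0, η > 0, ζ ≥ 0, φ ∈ (0,∞)^n), one has β_{ζ,k}^{(a,b)}(φ; η) ≥ β_k(φ; η) · ₁F_{1,k}(a; b; −ζ^k/(η^k n^n)), where β_k(φ; η) = (1/k^{n−1}) ∫_{E_{n-1}} ∏_i t_i^{φ_i/k−1} e^{−η^k/(kπ(t))} dt. -/

import Mathlib

open MeasureTheory Real Set

noncomputable section

/-- Open standard (n-1)-simplex in ℝ^{n-1}. -/
def simplexInt (n : ℕ) : Set (Fin (n-1) → ℝ) :=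
  {t | (∀ i, 0 < t i) ∧ ∑ i, t i < 1}

/-- Barycentric coordinates: `t_1, …, t_{n-1}` and `t_n = 1 - ∑_{i<n} t_i`. -/
def bary (n : ℕ) (t : Fin (n-1) → ℝ) (i : Fin n) : ℝ :=
  if h : (i : ℕ) < n - 1 then t ⟨i, h⟩ else 1 - ∑ j, t j

/-- Product of the n barycentric coordinates. -/
def piT (n : ℕ) (t : Fin (n-1) → ℝ) : ℝ := ∏ i : Fin n, bary n t i

/-- Euler-integral confluent hypergeometric k-function ₁F_{1,k}(a;b;l). -/
def F1k (k a b l : ℝ) : ℝ :=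
  (1/k) * (Real.Gamma b / (Real.Gamma a * Real.Gamma (b-a))) *
    ∫ u in Set.Ioo (0:ℝ) 1, u ^ (a/k - 1) * (1-u) ^ ((b-a)/k - 1) * Real.exp (l*u)

/-- Beta k-function of n variables. -/
def betaK (n : ℕ) (k : ℝ) (φ : Fin n → ℝ) : ℝ :=
  (1/k^(n-1)) * ∫ t in simplexInt n, ∏ i, bary n t i ^ (φ i / k - 1)

/-- Extended beta k-function β_k(φ; η). -/
def betaKe (n : ℕ) (k : ℝ) (φ : Fin n → ℝ) (η : ℝ) : ℝ :=
  (1/k^(n-1)) * ∫ t in simplexInt n,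
    (∏ i, bary n t i ^ (φ i / k - 1)) * Real.exp (-(η^k)/(k * piT n t))

/-- Generalized beta k-function of the first kind. -/
def betaFirst (n : ℕ) (k a b η ζ : ℝ) (φ : Fin n → ℝ) : ℝ :=
  (1/k^(n-1)) * ∫ t in simplexInt n,
    (∏ i, bary n t i ^ (φ i / k - 1)) *
      F1k k a b (-(η^k)/(k * piT n t) - ζ^k * piT n t / η^k)

/-- Generalized beta k-function of the second kind. -/
def betaSecond (n : ℕ) (k : ℝ) (p q η ζ φ : Fin n → ℝ) : ℝ :=
  (1/k^(n-1)) * ∫ t in simplexInt n,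
    ∏ i, (bary n t i ^ (φ i / k - 1) *
      F1k k (p i) (q i) (-((η i)^k)/(k * bary n t i) - (ζ i)^k * bary n t i / (η i)^k))

/-- Extended beta k-function of the second kind (vector η). -/
def betaKe2 (n : ℕ) (k : ℝ) (φ η : Fin n → ℝ) : ℝ :=
  (1/k^(n-1)) * ∫ t in simplexInt n,
    ∏ i, (bary n t i ^ (φ i / k - 1) * Real.exp (-((η i)^k)/(k * bary n t i)))

section Dirichlet

variable {ι : Type*} [Fintype ι]

/-- The linear involution replacing the `j`-th coordinate by minus the sum of all coordinates. -/
def negSumLinear [DecidableEq ι] (j : ι) : (ι → ℝ) →ₗ[ℝ] (ι → ℝ) where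
  toFun t := Function.update t j (-∑ i, t i)
  map_add' s t := by
    ext i
    by_cases h : i = j
    · subst h; simp [Finset.sum_add_distrib]; ring
    · simp [h]
  map_smul' c t := by
    ext i
    by_cases h : i = j
    · subst h; simp [← Finset.mul_sum]
    · simp [h]

lemma negSumLinear_comp_self [DecidableEq ι] (j : ι) :
    negSumLinear j ∘ₗ negSumLinear j = LinearMap.id := by
  refine LinearMap.ext fun t => ?_
  change Function.update (Function.update t j (-∑ i, t i)) j
    (-∑ i, Function.update t j (-∑ i, t i) i) = t
  rw [Finset.sum_update_of_mem (Finset.mem_univ j), Function.update_idem,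
    ← Finset.add_sum_erase _ t (Finset.mem_univ j), Finset.sdiff_singleton_eq_erase]
  convert! Function.update_eq_self j t using 2
  ring

lemma abs_det_negSumLinear [DecidableEq ι] (j : ι) : |LinearMap.det (negSumLinear j)| = 1 := by
  have h := congrArg LinearMap.det (negSumLinear_comp_self j)
  rw [LinearMap.det_comp, LinearMap.det_id] at h
  rcases mul_self_eq_one_iff.1 h with h | h <;> simp [h]

/-- Swapping the `j`-th barycentric coordinate with the last one preserves volume. -/
lemma measurePreserving_update_one_sub_sum [DecidableEq ι] (j : ι) :
    MeasurePreserving (fun t : ι → ℝ => Function.update t j (1 - ∑ i, t i)) := by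
  have hdet : LinearMap.det (negSumLinear j) ≠ 0 := by
    intro h
    simpa [h] using abs_det_negSumLinear j
  have h1 : MeasurePreserving (negSumLinear j) (volume : Measure (ι → ℝ)) volume := by
    refine ⟨(LinearMap.continuous_of_finiteDimensional _).measurable, ?_⟩
    rw [Measure.map_linearMap_addHaar_eq_smul_addHaar _ hdet, abs_inv, abs_det_negSumLinear]
    simp
  have h2 := (measurePreserving_add_right (volume : Measure (ι → ℝ)) (Pi.single j 1)).comp h1
  convert! h2 using 1
  ext t i
  change _ = Function.update t j (-∑ i, t i) i + _
  by_cases h : i = j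
  · subst h; simp; ring
  · simp [h]

/-- The Dirichlet density with exponents `α` and `α₀`, up to normalisation. -/
def dirichletWeight (α : ι → ℝ) (α₀ : ℝ) (t : ι → ℝ) : ℝ :=
  (∏ i, t i ^ (α i - 1)) * (1 - ∑ i, t i) ^ (α₀ - 1)

lemma measurable_dirichletWeight (α : ι → ℝ) (α₀ : ℝ) : Measurable (dirichletWeight α α₀) := by
  unfold dirichletWeight
  fun_prop

lemma dirichletWeight_update [DecidableEq ι] (α : ι → ℝ) (α₀ : ℝ) (j : ι) (t : ι → ℝ) :
    dirichletWeight (Function.update α j α₀) (α j) (Function.update t j (1 - ∑ i, t i)) =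
      dirichletWeight α α₀ t := by
  have h : ∏ i ∈ Finset.univ.erase j,
      Function.update t j (1 - ∑ i, t i) i ^ (Function.update α j α₀ i - 1) =
        ∏ i ∈ Finset.univ.erase j, t i ^ (α i - 1) :=
    Finset.prod_congr rfl fun i hi => by simp [Finset.ne_of_mem_erase hi]
  have hs : 1 - ∑ i, Function.update t j (1 - ∑ i, t i) i = t j := by
    rw [Finset.sum_update_of_mem (Finset.mem_univ j),
      ← Finset.add_sum_erase _ t (Finset.mem_univ j), Finset.sdiff_singleton_eq_erase]
    ring
  unfold dirichletWeight
  rw [hs, ← Finset.mul_prod_erase _ _ (Finset.mem_univ j), h,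
    ← Finset.mul_prod_erase _ (fun i => t i ^ (α i - 1)) (Finset.mem_univ j)]
  simp only [Function.update_self]
  ring

lemma integrableOn_prod_rpow {α : ι → ℝ} (hα : ∀ i, 0 < α i) :
    IntegrableOn (fun t : ι → ℝ => ∏ i, t i ^ (α i - 1)) (univ.pi fun _ => Ioo 0 1) := by
  rw [IntegrableOn, volume_pi, Measure.restrict_pi_pi]
  refine Integrable.fintype_prod (f := fun i x => x ^ (α i - 1)) fun i => ?_
  exact (intervalIntegral.integrableOn_Ioo_rpow_iff one_pos).2 (by linarith [hα i])

lemma measurableSet_simplex_inter (c : ℝ) :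
    MeasurableSet {t : ι → ℝ | (∀ i, 0 < t i) ∧ ∑ i, t i < 1 ∧ c ≤ 1 - ∑ i, t i} := by
  measurability

lemma integrableOn_dirichletWeight_of_le {α : ι → ℝ} (hα : ∀ i, 0 < α i) (α₀ : ℝ) {c : ℝ}
    (hc : 0 < c) :
    IntegrableOn (dirichletWeight α α₀)
      {t | (∀ i, 0 < t i) ∧ ∑ i, t i < 1 ∧ c ≤ 1 - ∑ i, t i} := by
  refine Integrable.mul_bdd (c := max (c ^ (α₀ - 1)) 1)
    ((integrableOn_prod_rpow hα).mono_set ?_)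
    (Measurable.aestronglyMeasurable (by fun_prop)) ?_
  · intro t ht i _
    exact ⟨ht.1 i, (Finset.single_le_sum (fun i _ => (ht.1 i).le) (Finset.mem_univ i)).trans_lt
      ht.2.1⟩
  · filter_upwards [ae_restrict_mem (measurableSet_simplex_inter c)] with t ht
    have h0 : 0 < 1 - ∑ i, t i := by linarith [ht.2.1]
    have h1 : 1 - ∑ i, t i ≤ 1 := by
      linarith [Finset.sum_nonneg fun i (_ : i ∈ Finset.univ) => (ht.1 i).le]
    rw [Real.norm_of_nonneg (rpow_nonneg h0.le _)]
    rcases le_total 0 (α₀ - 1) with h | h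
    · exact le_max_of_le_right (rpow_le_one h0.le h1 h)
    · exact le_max_of_le_left (rpow_le_rpow_of_nonpos hc ht.2.2 h)

/-- The Dirichlet density is integrable on the open simplex. -/
lemma integrableOn_dirichletWeight {α : ι → ℝ} (hα : ∀ i, 0 < α i) {α₀ : ℝ} (hα₀ : 0 < α₀) :
    IntegrableOn (dirichletWeight α α₀) {t | (∀ i, 0 < t i) ∧ ∑ i, t i < 1} := by
  classical
  let c : ℝ := 1 / (Fintype.card ι + 1)
  have hc : 0 < c := by positivity
  let A : Set (ι → ℝ) := {t | (∀ i, 0 < t i) ∧ ∑ i, t i < 1 ∧ c ≤ 1 - ∑ i, t i}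
  let T : ι → (ι → ℝ) → (ι → ℝ) := fun j t => Function.update t j (1 - ∑ i, t i)
  have hT : ∀ j, IntegrableOn (dirichletWeight α α₀) (T j ⁻¹' A) := by
    intro j
    have hint : IntegrableOn (dirichletWeight (Function.update α j α₀) (α j)) A := by
      refine integrableOn_dirichletWeight_of_le (fun i => ?_) _ hc
      by_cases h : i = j
      · subst h; simpa using hα₀
      · simpa [h] using hα i
    have hmp := (measurePreserving_update_one_sub_sum j).restrict_preimage
      (measurableSet_simplex_inter c)
    have := hmp.integrable_comp_of_integrable hint
    refine this.congr (Filter.Eventually.of_forall fun t => ?_)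
    exact dirichletWeight_update α α₀ j t
  refine ((integrableOn_dirichletWeight_of_le hα α₀ hc).union
    (integrableOn_finite_iUnion.2 hT)).mono_set ?_
  intro t ht
  by_contra hcon
  simp only [mem_union, mem_iUnion, mem_preimage, not_or, not_exists] at hcon
  have h0 : 1 - ∑ i, t i < c := by
    by_contra! h
    exact hcon.1 ⟨ht.1, ht.2, h⟩
  have hj : ∀ j, t j ≤ c := by
    intro j
    by_contra! h
    have hs : ∑ i, T j t i = 1 - t j := by
      rw [Finset.sum_update_of_mem (Finset.mem_univ j),
        ← Finset.add_sum_erase _ t (Finset.mem_univ j), Finset.sdiff_singleton_eq_erase]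
      ring
    refine hcon.2 j ⟨fun i => ?_, ?_, ?_⟩
    · by_cases hi : i = j
      · subst hi; simpa [T] using ht.2
      · simpa [T, hi] using ht.1 i
    · linarith [ht.1 j]
    · linarith
  have hsum : ∑ i, t i ≤ Fintype.card ι * c := by
    simpa using Finset.sum_le_sum fun i (_ : i ∈ Finset.univ) => hj i
  have hone : (Fintype.card ι + 1) * c = 1 := by
    simp only [c]; field_simp
  linarith

end Dirichlet

section EulerIntegral

lemma integrableOn_rpow_mul_one_sub_rpow {p q : ℝ} (hp : 0 < p) (hq : 0 < q) :
    IntegrableOn (fun u : ℝ => u ^ (p - 1) * (1 - u) ^ (q - 1)) (Ioo 0 1) := by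
  have h := Complex.betaIntegral_convergent (u := p) (v := q) (by simpa) (by simpa)
  rw [intervalIntegrable_iff_integrableOn_Ioo_of_le zero_le_one] at h
  refine h.norm.congr ?_
  filter_upwards [ae_restrict_mem measurableSet_Ioo] with u hu
  have h1 : (0 : ℝ) < 1 - u := by linarith [hu.2]
  rw [norm_mul, Complex.norm_cpow_eq_rpow_re_of_pos hu.1, ← Complex.ofReal_one,
    ← Complex.ofReal_sub, ← Complex.ofReal_sub, ← Complex.ofReal_sub,
    Complex.norm_cpow_eq_rpow_re_of_pos h1, Complex.ofReal_re, Complex.ofReal_re]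

variable {k a b : ℝ}

lemma integrableOn_F1k (hk : 0 < k) (ha : 0 < a) (hab : 0 < b - a) (l : ℝ) :
    IntegrableOn (fun u : ℝ => u ^ (a / k - 1) * (1 - u) ^ ((b - a) / k - 1) * exp (l * u))
      (Ioo 0 1) := by
  refine Integrable.mul_bdd (c := exp |l|)
    (integrableOn_rpow_mul_one_sub_rpow (div_pos ha hk) (div_pos hab hk))
    (Measurable.aestronglyMeasurable (by fun_prop)) ?_
  filter_upwards [ae_restrict_mem measurableSet_Ioo] with u hu
  rw [Real.norm_of_nonneg (exp_pos _).le, exp_le_exp]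
  calc l * u ≤ |l| * u := mul_le_mul_of_nonneg_right (le_abs_self l) hu.1.le
    _ ≤ |l| := mul_le_of_le_one_right (abs_nonneg l) hu.2.le

lemma F1k_coeff_nonneg (hk : 0 < k) (ha : 0 < a) (hab : 0 < b - a) :
    0 ≤ (1 / k) * (Real.Gamma b / (Real.Gamma a * Real.Gamma (b - a))) := by
  have := Real.Gamma_pos_of_pos ha
  have := Real.Gamma_pos_of_pos hab
  have := Real.Gamma_pos_of_pos (show 0 < b by linarith)
  positivity

lemma F1k_nonneg (hk : 0 < k) (ha : 0 < a) (hab : 0 < b - a) (l : ℝ) : 0 ≤ F1k k a b l := by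
  refine mul_nonneg (F1k_coeff_nonneg hk ha hab) (setIntegral_nonneg measurableSet_Ioo ?_)
  intro u hu
  have h1 : (0 : ℝ) ≤ 1 - u := by linarith [hu.2]
  have h0 : 0 ≤ u := hu.1.le
  positivity

lemma exp_mul_F1k_le (hk : 0 < k) (ha : 0 < a) (hab : 0 < b - a) {x y z : ℝ} (hx : x ≤ 0)
    (hyz : y ≤ z) : exp x * F1k k a b y ≤ F1k k a b (x + z) := by
  unfold F1k
  rw [mul_left_comm, ← integral_const_mul]
  refine mul_le_mul_of_nonneg_left ?_ (F1k_coeff_nonneg hk ha hab)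
  refine setIntegral_mono_on ((integrableOn_F1k hk ha hab y).const_mul _)
    (integrableOn_F1k hk ha hab _) measurableSet_Ioo fun u hu => ?_
  have h1 : (0 : ℝ) ≤ 1 - u := by linarith [hu.2]
  have h0 : 0 ≤ u := hu.1.le
  rw [mul_left_comm, ← exp_add]
  gcongr
  nlinarith [mul_nonneg h0 (sub_nonneg.2 hyz), mul_nonneg (neg_nonneg.2 hx) h1]

lemma F1k_monotone (hk : 0 < k) (ha : 0 < a) (hab : 0 < b - a) : Monotone (F1k k a b) := by
  intro y z hyz
  simpa using exp_mul_F1k_le hk ha hab le_rfl hyz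

end EulerIntegral

section Barycentric

lemma measurable_bary (n : ℕ) (i : Fin n) : Measurable fun t => bary n t i := by
  unfold bary
  split_ifs <;> fun_prop

lemma measurable_piT (n : ℕ) : Measurable (piT n) :=
  Finset.measurable_fun_prod _ fun i _ => measurable_bary n i

lemma bary_pos {n : ℕ} {t : Fin (n - 1) → ℝ} (ht : t ∈ simplexInt n) (i : Fin n) :
    0 < bary n t i := by
  unfold bary
  split_ifs
  · exact ht.1 _
  · linarith [ht.2]

lemma measurableSet_simplexInt (n : ℕ) : MeasurableSet (simplexInt n) := by
  unfold simplexInt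
  measurability

lemma bary_castSucc {m : ℕ} (t : Fin m → ℝ) (i : Fin m) : bary (m + 1) t i.castSucc = t i := by
  simp [bary]

lemma bary_last {m : ℕ} (t : Fin m → ℝ) : bary (m + 1) t (Fin.last m) = 1 - ∑ i, t i := by
  simp [bary]

lemma sum_bary {n : ℕ} (hn : n ≠ 0) (t : Fin (n - 1) → ℝ) : ∑ i, bary n t i = 1 := by
  obtain ⟨m, rfl⟩ := Nat.exists_eq_succ_of_ne_zero hn
  rw [Fin.sum_univ_castSucc]
  simp only [bary_castSucc, bary_last, Nat.succ_eq_add_one]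
  simp

lemma piT_le {n : ℕ} (hn : n ≠ 0) {t : Fin (n - 1) → ℝ} (ht : t ∈ simplexInt n) :
    piT n t ≤ 1 / (n : ℝ) ^ n := by
  have hn' : (n : ℝ) ≠ 0 := Nat.cast_ne_zero.2 hn
  have h := Real.geom_mean_le_arith_mean_weighted Finset.univ (fun _ : Fin n => (n : ℝ)⁻¹)
    (bary n t) (fun _ _ => by positivity) (by simp [hn']) fun i _ => (bary_pos ht i).le
  rw [← Finset.mul_sum, sum_bary hn, mul_one,
    Real.finsetProd_rpow _ _ fun i _ => (bary_pos ht i).le] at h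
  have h0 : 0 ≤ piT n t := Finset.prod_nonneg fun i _ => (bary_pos ht i).le
  have h2 := pow_le_pow_left₀ (rpow_nonneg h0 _) h n
  rwa [Real.rpow_inv_natCast_pow h0 hn, inv_pow, ← one_div] at h2

lemma integrableOn_prod_bary_rpow {n : ℕ} (hn : n ≠ 0) {α : Fin n → ℝ} (hα : ∀ i, 0 < α i) :
    IntegrableOn (fun t => ∏ i, bary n t i ^ (α i - 1)) (simplexInt n) := by
  obtain ⟨m, rfl⟩ := Nat.exists_eq_succ_of_ne_zero hn
  refine (integrableOn_dirichletWeight (fun i : Fin m => hα i.castSucc)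
    (hα (Fin.last m))).congr (Filter.Eventually.of_forall fun t => ?_)
  change _ = ∏ i : Fin (m + 1), bary (m + 1) t i ^ (α i - 1)
  rw [Fin.prod_univ_castSucc]
  simp only [bary_castSucc, bary_last, dirichletWeight]

end Barycentric

theorem stmt11 (n : ℕ) (hn : 2 ≤ n) (k a b η ζ : ℝ) (hk : 0 < k) (ha : 0 < a)
    (hab : 0 < b - a) (hη : 0 < η) (hζ : 0 ≤ ζ)
    (φ : Fin n → ℝ) (hφ : ∀ i, 0 < φ i) :
    betaKe n k φ η * F1k k a b (-(ζ^k) / (η^k * (n:ℝ)^n)) ≤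
      betaFirst n k a b η ζ φ := by
  have hn0 : n ≠ 0 := by omega
  have hηk : 0 < η ^ k := rpow_pos_of_pos hη k
  have hζk : 0 ≤ ζ ^ k := rpow_nonneg hζ k
  have hpi : ∀ t ∈ simplexInt n, 0 < piT n t := fun t ht =>
    Finset.prod_pos fun i _ => bary_pos ht i
  have hprod : ∀ t ∈ simplexInt n, 0 ≤ ∏ i, bary n t i ^ (φ i / k - 1) := fun t ht =>
    Finset.prod_nonneg fun i _ => rpow_nonneg (bary_pos ht i).le _
  have hmeas : Measurable fun t =>
      F1k k a b (-(η ^ k) / (k * piT n t) - ζ ^ k * piT n t / η ^ k) := by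
    have := measurable_piT n
    exact (F1k_monotone hk ha hab).measurable.comp (by fun_prop)
  have hX : ∀ t ∈ simplexInt n, -(η ^ k) / (k * piT n t) ≤ 0 := fun t ht =>
    div_nonpos_of_nonpos_of_nonneg (by linarith) (mul_pos hk (hpi t ht)).le
  unfold betaKe betaFirst
  rw [mul_assoc, ← integral_mul_const]
  refine mul_le_mul_of_nonneg_left (integral_mono_of_nonneg ?_ ?_ ?_) (by positivity)
  · filter_upwards [ae_restrict_mem (measurableSet_simplexInt n)] with t ht
    exact mul_nonneg (mul_nonneg (hprod t ht) (exp_pos _).le) (F1k_nonneg hk ha hab _)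
  · refine Integrable.mul_bdd (c := F1k k a b 0)
      (integrableOn_prod_bary_rpow hn0 fun i => div_pos (hφ i) hk) hmeas.aestronglyMeasurable ?_
    filter_upwards [ae_restrict_mem (measurableSet_simplexInt n)] with t ht
    rw [Real.norm_of_nonneg (F1k_nonneg hk ha hab _)]
    refine F1k_monotone hk ha hab (sub_nonpos.2 ((hX t ht).trans ?_))
    have := hpi t ht
    positivity
  · filter_upwards [ae_restrict_mem (measurableSet_simplexInt n)] with t ht
    rw [mul_assoc, sub_eq_add_neg]
    refine mul_le_mul_of_nonneg_left (exp_mul_F1k_le hk ha hab (hX t ht) ?_) (hprod t ht)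
    rw [neg_div, neg_le_neg_iff]
    calc ζ ^ k * piT n t / η ^ k ≤ ζ ^ k * (1 / (n : ℝ) ^ n) / η ^ k := by
          gcongr
          exact piT_le hn0 ht
      _ = ζ ^ k / (η ^ k * (n : ℝ) ^ n) := by field_simp
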